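/- For every integer n ≥ 7, the boxicity of the complement of the line graph L(K_n) is at least n − 2. -/

import Mathlib

/-- An assignment of axis-parallel boxes in `ℝ^d` (given coordinate-wise, as `d` nonempty closed
intervals per vertex) representing the graph `G`: two distinct vertices are adjacent iff their
boxes intersect, i.e. iff the intervals intersect in every coordinate. -/
def SimpleGraph.IsBoxRep {V : Type*} (G : SimpleGraph V) (d : ℕ) (I : V → Fin d → Set ℝ) : Prop :=
  (∀ v i, ∃ a b : ℝ, a ≤ b ∧ I v i = Set.Icc a b) ∧
  ∀ u v : V, u ≠ v → (G.Adj u v ↔ ∀ i, (I u i ∩ I v i).Nonempty)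

/-- The boxicity of a graph: the least dimension `d` such that `G` has a representation by
axis-parallel boxes in `ℝ^d`. -/
noncomputable def SimpleGraph.boxicity {V : Type*} (G : SimpleGraph V) : ℕ :=
  sInf {d : ℕ | ∃ I : V → Fin d → Set ℝ, G.IsBoxRep d I}

/-- `G` is an interval graph: its vertices can be assigned nonempty closed real intervals so that
two distinct vertices are adjacent iff their intervals intersect. -/
def SimpleGraph.IsIntervalGraph {V : Type*} (G : SimpleGraph V) : Prop :=
  ∃ I : V → Set ℝ, (∀ v, ∃ a b : ℝ, a ≤ b ∧ I v = Set.Icc a b) ∧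
    ∀ u v : V, u ≠ v → (G.Adj u v ↔ (I u ∩ I v).Nonempty)

/-- An interval-order graph is the complement of an interval graph. -/
def SimpleGraph.IsIntervalOrderGraph {V : Type*} (G : SimpleGraph V) : Prop :=
  Gᶜ.IsIntervalGraph

/-- `r a b c d` is read as `ab < cd`. The relation `r` is an interval order on the edges of the
complete graph on `α` (irreflexive and without `2 + 2`) in which comparable edges are distinct and
share a vertex. -/
structure IsLineIntervalOrder {α : Type*} (r : α → α → α → α → Prop) : Prop where
  swap_left : ∀ {a b c d}, r a b c d → r b a c d
  swap_right : ∀ {a b c d}, r a b c d → r a b d c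
  ferrers : ∀ {a b c d a' b' c' d'}, r a b c d → r a' b' c' d' → r a b c' d' ∨ r a' b' c d
  cherry : ∀ {a b c d}, r a b c d →
    a ≠ b ∧ c ≠ d ∧ (a = c ∧ b ≠ d ∨ a = d ∧ b ≠ c ∨ b = c ∧ a ≠ d ∨ b = d ∧ a ≠ c)

/-- The edges `vx` and `vy` are comparable in `r`. -/
def Cmp {α : Type*} (r : α → α → α → α → Prop) (v x y : α) : Prop := r v x v y ∨ r v y v x

namespace IsLineIntervalOrder

variable {α : Type*} {r : α → α → α → α → Prop}

theorem trans (hr : IsLineIntervalOrder r) {a b c d e f : α} (h₁ : r a b c d) (h₂ : r c d e f) :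
    r a b e f :=
  (hr.ferrers h₁ h₂).resolve_right fun h => by have := hr.cherry h; grind

theorem reverse (hr : IsLineIntervalOrder r) : IsLineIntervalOrder (fun a b c d => r c d a b) where
  swap_left h := hr.swap_right h
  swap_right h := hr.swap_left h
  ferrers h₁ h₂ := (hr.ferrers h₁ h₂).symm
  cherry h := by have := hr.cherry h; grind

theorem comap (hr : IsLineIntervalOrder r) {β : Type*} (f : β ↪ α) :
    IsLineIntervalOrder (fun a b c d => r (f a) (f b) (f c) (f d)) where
  swap_left h := hr.swap_left h
  swap_right h := hr.swap_right h
  ferrers h₁ h₂ := hr.ferrers h₁ h₂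
  cherry h := by
    have := hr.cherry h
    simp only [ne_eq, f.injective.eq_iff] at this
    exact this

theorem rel_of_rel_of_cmp (hr : IsLineIntervalOrder r) {a b c d : α} (h : r a b a c)
    (hcmp : Cmp r b a d) (hcd : c ≠ d) (hda : d ≠ a) : r b a b d := by
  refine hcmp.resolve_right fun h' => ?_
  have h₁ := hr.cherry h
  have h₂ := hr.cherry h'
  have h₃ := hr.cherry (hr.trans h' (hr.swap_left h))
  grind

theorem rel_of_rel_of_cmp' (hr : IsLineIntervalOrder r) {a b c d : α} (h : r a b a c)
    (hcmp : Cmp r c d a) (hbd : b ≠ d) (hda : d ≠ a) : r c d c a :=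
  hr.reverse.rel_of_rel_of_cmp h hcmp hbd hda

theorem not_cmp_of_between (hr : IsLineIntervalOrder r) {v x y z u : α} (h₁ : r x y x v)
    (h₂ : r x v x z) (hux : u ≠ x) (huy : u ≠ y) (huz : u ≠ z) : ¬ Cmp r v x u := by
  have := hr.cherry h₁
  have := hr.cherry h₂
  rintro (h | h)
  · have := hr.cherry (hr.trans h₁ (hr.swap_left h))
    grind
  · have := hr.cherry (hr.trans (hr.swap_right h) h₂)
    grind

/-- If `vx` is below an edge `xy` avoiding `v` then `vx` can only be below `vu`. -/
theorem rel_of_cmp_of_rel (hr : IsLineIntervalOrder r) {v x y u : α} (h : r v x x y)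
    (hcmp : Cmp r v x u) (hux : u ≠ x) (huy : u ≠ y) : r v x v u := by
  refine hcmp.resolve_right fun h' => ?_
  have h₁ := hr.cherry h
  have h₂ := hr.cherry h'
  have h₃ := hr.cherry (hr.trans h' h)
  grind

/-- A lowest pair of disjoint edges `ac`, `bd`: one of them is not compared with the edges that
join its ends to `u`. -/
theorem not_cmp_of_disjoint (hr : IsLineIntervalOrder r) {a b c d u : α} (hab : a ≠ b)
    (had : a ≠ d) (hcb : c ≠ b) (hcd : c ≠ d) (hau : a ≠ u) (hbu : b ≠ u) (hcu : c ≠ u)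
    (hdu : d ≠ u) (h₁ : r a c c d) (h₂ : r c a a b) (h₃ : r b d d c) (h₄ : r d b b a) :
    (¬ Cmp r a c u ∧ ¬ Cmp r c a u) ∨ (¬ Cmp r b d u ∧ ¬ Cmp r d b u) := by
  by_contra! hcon
  have hac : r a c a u ∨ r a c c u := by
    by_cases h : Cmp r a c u
    · exact .inl (hr.rel_of_cmp_of_rel h₁ h hcu.symm hdu.symm)
    · exact .inr (hr.swap_left (hr.rel_of_cmp_of_rel h₂ (hcon.1 h) hau.symm hbu.symm))
  have hbd : r b d b u ∨ r b d d u := by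
    by_cases h : Cmp r b d u
    · exact .inl (hr.rel_of_cmp_of_rel h₃ h hdu.symm hcu.symm)
    · exact .inr (hr.swap_left (hr.rel_of_cmp_of_rel h₄ (hcon.2 h) hbu.symm hau.symm))
  rcases hac with h | h <;> rcases hbd with h' | h' <;>
    rcases hr.ferrers h h' with h'' | h'' <;>
    have := hr.cherry h'' <;> grind

theorem false_of_cmp_of_rel (hr : IsLineIntervalOrder r) {W : Set α} {a b c d u : α} (hu : u ∉ W)
    (ha : a ∈ W) (hb : b ∈ W) (hc : c ∈ W) (hd : d ∈ W) (hab : a ≠ b) (hac : a ≠ c) (had : a ≠ d)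
    (hbc : b ≠ c) (hbd : b ≠ d) (hcd : c ≠ d)
    (hW : ∀ v ∈ W, ∀ x ∈ W, ∀ y ∈ W, ¬ r v x v y)
    (h₁ : r a u a b) (h₂ : r b u b a) (h₃ : r c d c u) (h₄ : r d c d u)
    (h₅ : (Cmp r a c u ∧ Cmp r c a u) ∨ (Cmp r b d u ∧ Cmp r d b u))
    (h₆ : (Cmp r a d u ∧ Cmp r d a u) ∨ (Cmp r b c u ∧ Cmp r c b u)) : False := by
  have key₁ : ∀ v ∈ W, ∀ w ∈ W, ∀ x ∈ W, r v u v w → Cmp r v x u → r v u v x :=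
    fun v hv w hw x hx h h' => h'.resolve_left fun h'' => hW v hv x hx w hw (hr.trans h'' h)
  have key₂ : ∀ v ∈ W, ∀ w ∈ W, ∀ x ∈ W, r v w v u → Cmp r v x u → r v x v u :=
    fun v hv w hw x hx h h' => h'.resolve_right fun h'' => hW v hv w hw x hx (hr.trans h h'')
  have hau : a ≠ u := by rintro rfl; exact hu ha
  have hbu : b ≠ u := by rintro rfl; exact hu hb
  have hcu : c ≠ u := by rintro rfl; exact hu hc
  have hdu : d ≠ u := by rintro rfl; exact hu hd
  rcases h₅ with ⟨h, h'⟩ | ⟨h, h'⟩ <;> rcases h₆ with ⟨k, k'⟩ | ⟨k, k'⟩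
  · have e := key₂ c hc d hd a ha h₃ h'
    have f := key₂ d hd c hc a ha h₄ k'
    rcases hr.ferrers e f with g | g <;> have := hr.cherry g <;> grind
  · have e := key₁ a ha b hb c hc h₁ h
    have f := key₁ b hb a ha c hc h₂ k
    rcases hr.ferrers e f with g | g <;> have := hr.cherry g <;> grind
  · have e := key₁ b hb a ha d hd h₂ h
    have f := key₁ a ha b hb d hd h₁ k
    rcases hr.ferrers e f with g | g <;> have := hr.cherry g <;> grind
  · have e := key₂ d hd c hc b hb h₄ h'
    have f := key₂ c hc d hd b hb h₃ k'
    rcases hr.ferrers e f with g | g <;> have := hr.cherry g <;> grind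

theorem false_of_cmp (hr : IsLineIntervalOrder r) {W : Set α} {a b c d u : α} (hu : u ∉ W)
    (ha : a ∈ W) (hb : b ∈ W) (hc : c ∈ W) (hd : d ∈ W) (hab : a ≠ b) (hac : a ≠ c) (had : a ≠ d)
    (hbc : b ≠ c) (hbd : b ≠ d) (hcd : c ≠ d)
    (hW : ∀ v ∈ W, ∀ x ∈ W, ∀ y ∈ W, ¬ r v x v y)
    (h₁ : Cmp r a b u) (h₂ : Cmp r b a u) (h₃ : Cmp r c d u) (h₄ : Cmp r d c u)
    (h₅ : (Cmp r a c u ∧ Cmp r c a u) ∨ (Cmp r b d u ∧ Cmp r d b u))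
    (h₆ : (Cmp r a d u ∧ Cmp r d a u) ∨ (Cmp r b c u ∧ Cmp r c b u)) : False := by
  have key : ∀ {v w x y}, v ∈ W → w ∈ W → x ∈ W → y ∈ W → v ≠ x → v ≠ y → w ≠ x → w ≠ y →
      r v u v w → r x u x y → False := by
    intro v w x y hv hw hx hy h₁ h₂ h₃ h₄ h h'
    rcases hr.ferrers h h' with g | g <;> have := hr.cherry g <;> grind
  have key' : ∀ {v w x y}, v ∈ W → w ∈ W → x ∈ W → y ∈ W → v ≠ x → v ≠ y → w ≠ x → w ≠ y →
      r v w v u → r x y x u → False := by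
    intro v w x y hv hw hx hy h₁ h₂ h₃ h₄ h h'
    rcases hr.ferrers h h' with g | g <;> have := hr.cherry g <;> grind
  rcases h₁ with h₁ | h₁
  · have h₃' := h₃.resolve_left fun h => key' ha hb hc hd hac had hbc hbd h₁ h
    have h₄' := h₄.resolve_left fun h => key' ha hb hd hc had hac hbd hbc h₁ h
    have h₂' := h₂.resolve_right fun h => key hb ha hc hd hbc hbd hac had h h₃'
    exact hr.false_of_cmp_of_rel hu hc hd ha hb hcd hac.symm hbc.symm had.symm hbd.symm hab hW
      h₃' h₄' h₁ h₂' (by tauto) (by tauto)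
  · have h₃' := h₃.resolve_right fun h => key ha hb hc hd hac had hbc hbd h₁ h
    have h₄' := h₄.resolve_right fun h => key ha hb hd hc had hac hbd hbc h₁ h
    have h₂' := h₂.resolve_left fun h => key' hb ha hc hd hbc hbd hac had h h₃'
    exact hr.false_of_cmp_of_rel hu ha hb hc hd hab hac had hbc hbd hcd hW h₁ h₂' h₃' h₄' h₅ h₆

theorem false_of_four_of_rel {s : α → α → α → α → Prop} (hr : IsLineIntervalOrder r)
    (hs : IsLineIntervalOrder s) {W : Set α} {a b c d u : α} (hu : u ∉ W)
    (ha : a ∈ W) (hb : b ∈ W) (hc : c ∈ W) (hd : d ∈ W) (hab : a ≠ b) (hac : a ≠ c) (had : a ≠ d)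
    (hbc : b ≠ c) (hbd : b ≠ d) (hcd : c ≠ d)
    (hrW : ∀ v ∈ W, ∀ x ∈ W, ∀ y ∈ W, v ≠ x → v ≠ y → x ≠ y → Cmp r v x y)
    (hsW : ∀ v ∈ W, ∀ x ∈ W, ∀ y ∈ W, ¬ s v x v y)
    (hrs : ∀ v ∈ W, ∀ x ∈ W, v ≠ x → Cmp r v x u ∨ Cmp s v x u)
    (h₁ : r a c a b) (h₂ : r a b a d) : False := by
  have hau : a ≠ u := by rintro rfl; exact hu ha
  have hbu : b ≠ u := by rintro rfl; exact hu hb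
  have hcu : c ≠ u := by rintro rfl; exact hu hc
  have hdu : d ≠ u := by rintro rfl; exact hu hd
  have e₁ : r c a c d := hr.rel_of_rel_of_cmp h₁ (hrW c hc a ha d hd hac.symm hcd had) hbd had.symm
  have e₂ : r b d b a := hr.rel_of_rel_of_cmp' h₁ (hrW b hb d hd a ha hbd hab.symm had.symm)
    hcd had.symm
  have e₃ : r d b d c := hr.rel_of_rel_of_cmp e₂ (hrW d hd b hb c hc hbd.symm hcd.symm hbc)
    hac hbc.symm
  have f₁ : r b a b c := hr.rel_of_rel_of_cmp h₂ (hrW b hb a ha c hc hab.symm hbc hac)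
    hcd.symm hac.symm
  have f₂ : r d c d a := hr.rel_of_rel_of_cmp' h₂ (hrW d hd c hc a ha hcd.symm had.symm hac.symm)
    hbc hac.symm
  have f₃ : r c d c b := hr.rel_of_rel_of_cmp f₂ (hrW c hc d hd b hb hcd hbc.symm hbd.symm)
    hab hbd
  have low := hr.not_cmp_of_disjoint hab had hbc.symm hcd hau hbu hcu hdu
    (hr.swap_left e₁) (hr.swap_left h₁) (hr.swap_left e₃) (hr.swap_left e₂)
  have high := hr.reverse.not_cmp_of_disjoint hab hac hbd.symm hcd.symm hau hbu hdu hcu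
    (hr.swap_right f₂) (hr.swap_right h₂) (hr.swap_right f₃) (hr.swap_right f₁)
  have mid₁ := hr.not_cmp_of_between e₂ f₁ hbu.symm hdu.symm hcu.symm
  have mid₂ := hr.not_cmp_of_between h₁ h₂ hau.symm hcu.symm hdu.symm
  have mid₃ := hr.not_cmp_of_between e₃ f₂ hdu.symm hbu.symm hau.symm
  have mid₄ := hr.not_cmp_of_between e₁ f₃ hcu.symm hau.symm hbu.symm
  have rev : ∀ v x, Cmp (fun a b c d => r c d a b) v x u ↔ Cmp r v x u := fun v x => or_comm
  simp only [rev] at high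
  exact hs.false_of_cmp hu ha hb hc hd hab hac had hbc hbd hcd hsW
    ((hrs a ha b hb hab).resolve_left mid₁) ((hrs b hb a ha hab.symm).resolve_left mid₂)
    ((hrs c hc d hd hcd).resolve_left mid₃) ((hrs d hd c hc hcd.symm).resolve_left mid₄)
    (low.imp (fun h => ⟨(hrs a ha c hc hac).resolve_left h.1,
        (hrs c hc a ha hac.symm).resolve_left h.2⟩)
      fun h => ⟨(hrs b hb d hd hbd).resolve_left h.1, (hrs d hd b hb hbd.symm).resolve_left h.2⟩)
    (high.imp (fun h => ⟨(hrs a ha d hd had).resolve_left h.1,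
        (hrs d hd a ha had.symm).resolve_left h.2⟩)
      fun h => ⟨(hrs b hb c hc hbc).resolve_left h.1, (hrs c hc b hb hbc.symm).resolve_left h.2⟩)

/-- If all pairs of adjacent edges on four vertices are comparable in `r` and none in `s`, then
some pair `vx, vu` with `u` a fifth vertex is comparable in neither. -/
theorem false_of_four {s : α → α → α → α → Prop} (hr : IsLineIntervalOrder r)
    (hs : IsLineIntervalOrder s) {W : Set α} {a b c d u : α} (hu : u ∉ W)
    (ha : a ∈ W) (hb : b ∈ W) (hc : c ∈ W) (hd : d ∈ W) (hab : a ≠ b) (hac : a ≠ c) (had : a ≠ d)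
    (hbc : b ≠ c) (hbd : b ≠ d) (hcd : c ≠ d)
    (hrW : ∀ v ∈ W, ∀ x ∈ W, ∀ y ∈ W, v ≠ x → v ≠ y → x ≠ y → Cmp r v x y)
    (hsW : ∀ v ∈ W, ∀ x ∈ W, ∀ y ∈ W, ¬ s v x v y)
    (hrs : ∀ v ∈ W, ∀ x ∈ W, v ≠ x → Cmp r v x u ∨ Cmp s v x u) : False := by
  have key : ∀ x ∈ W, ∀ y ∈ W, ∀ z ∈ W, a ≠ x → a ≠ y → a ≠ z → x ≠ y → x ≠ z → y ≠ z →
      r a x a y → r a y a z → False :=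
    fun x hx y hy z hz h₁ h₂ h₃ h₄ h₅ h₆ h h' =>
      hr.false_of_four_of_rel hs hu ha hy hx hz h₂ h₁ h₃ h₄.symm h₆ h₅ hrW hsW hrs h h'
  have k := key b hb c hc d hd hab hac had hbc hbd hcd
  have k' := key b hb d hd c hc hab had hac hbd hbc hcd.symm
  have k'' := key c hc b hb d hd hac hab had hbc.symm hcd hbd
  have l := key c hc d hd b hb hac had hab hcd hbc.symm hbd.symm
  have l' := key d hd b hb c hc had hab hac hbd.symm hcd.symm hbc
  have l'' := key d hd c hc b hb had hac hab hcd.symm hbd.symm hbc.symm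
  have m := hrW a ha b hb c hc hab hac hbc
  have m' := hrW a ha b hb d hd hab had hbd
  have m'' := hrW a ha c hc d hd hac had hcd
  unfold Cmp at m m' m''
  tauto

end IsLineIntervalOrder
theorem Finset.card_add_card_le_card_univ {α : Type*} [Fintype α] {s t : Finset α}
    (h : Disjoint s t) : s.card + t.card ≤ Fintype.card α := by
  classical
  rw [← Finset.card_union_of_disjoint h]
  exact Finset.card_le_univ _

namespace IsLineIntervalOrder

variable {α : Type*} {r : α → α → α → α → Prop}

theorem exists_forall_rel [Finite α] [Nonempty α] (hr : IsLineIntervalOrder r) :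
    ∃ a b, ∀ p q s t, r p q s t → r a b s t := by
  obtain ⟨⟨a, b⟩, hab⟩ := Finite.exists_max
    (fun x : α × α => {f : α × α | r x.1 x.2 f.1 f.2}.ncard)
  refine ⟨a, b, fun p q s t h => by_contra fun hn => ?_⟩
  refine (hab (p, q)).not_gt (Set.ncard_lt_ncard ⟨fun f hf => ?_, fun hsub => ?_⟩)
  · exact (hr.ferrers hf h).resolve_left hn
  · exact hn (hsub (a := (s, t)) h)

theorem exists_extremal [Finite α] (hr : IsLineIntervalOrder r) {p q s t : α}
    (h : r p q s t) : ∃ a b c, r a b a c ∧ (∀ p q s t, r p q s t → r a b s t) ∧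
      ∀ p q s t, r p q s t → r p q a c := by
  have : Nonempty α := ⟨p⟩
  obtain ⟨a, b, hab⟩ := hr.exists_forall_rel
  obtain ⟨c, d, hcd⟩ := hr.reverse.exists_forall_rel
  have h' : r a b c d := hcd _ _ _ _ (hab _ _ _ _ h)
  have hcd' : ∀ p q s t, r p q s t → r p q c d := fun p q s t h => hcd s t p q h
  rcases (hr.cherry h').2.2 with ⟨rfl, -⟩ | ⟨rfl, -⟩ | ⟨rfl, -⟩ | ⟨rfl, -⟩
  · exact ⟨a, b, d, h', hab, hcd'⟩
  · exact ⟨a, b, c, hr.swap_right h', hab, fun p q s t h => hr.swap_right (hcd' _ _ _ _ h)⟩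
  · exact ⟨b, a, d, hr.swap_left h', fun p q s t h => hr.swap_left (hab _ _ _ _ h), hcd'⟩
  · exact ⟨b, a, c, hr.swap_left (hr.swap_right h'),
      fun p q s t h => hr.swap_left (hab _ _ _ _ h),
      fun p q s t h => hr.swap_right (hcd' _ _ _ _ h)⟩

end IsLineIntervalOrder

open scoped Classical in
/-- The number of pairs of edges that are comparable in `r`. -/
noncomputable def cmpCount {α : Type*} [Fintype α] (r : α → α → α → α → Prop) : ℕ :=
  (Finset.univ.filter fun t : α × α × α => r t.1 t.2.1 t.1 t.2.2).card

theorem cmpCount_reverse {α : Type*} [Fintype α] (r : α → α → α → α → Prop) :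
    cmpCount (fun a b c d => r c d a b) = cmpCount r := by
  classical
  unfold cmpCount
  refine Finset.card_bij (fun t _ => (t.1, t.2.2, t.2.1)) ?_ ?_ ?_
  · simp
  · rintro ⟨_, _, _⟩ _ ⟨_, _, _⟩ _ h
    simp_all
  · rintro ⟨v, x, y⟩ h
    exact ⟨(v, y, x), by simpa using h, rfl⟩

/-- The interval order `r` is not empty, and has `ab` as its lowest and `ac` as its highest edge. -/
structure IsExtremal {α : Type*} (r : α → α → α → α → Prop) (a b c : α) : Prop
    extends IsLineIntervalOrder r where
  rel : r a b a c
  lowest : ∀ p q s t, r p q s t → r a b s t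
  highest : ∀ p q s t, r p q s t → r p q a c

namespace IsExtremal

open Finset

variable {α : Type*} {r : α → α → α → α → Prop} {a b c : α}

theorem reverse (h : IsExtremal r a b c) : IsExtremal (fun a b c d => r c d a b) a c b where
  toIsLineIntervalOrder := h.toIsLineIntervalOrder.reverse
  rel := h.rel
  lowest p q s t := h.highest s t p q
  highest p q s t := h.lowest s t p q

theorem ne (h : IsExtremal r a b c) : a ≠ b ∧ a ≠ c ∧ b ≠ c := by
  have := h.cherry h.rel
  grind

theorem not_rel_left (h : IsExtremal r a b c) (p q : α) : ¬ r p q a b := fun h' => by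
  have := h.cherry (h.lowest _ _ _ _ h')
  grind

theorem not_rel_right (h : IsExtremal r a b c) (p q : α) : ¬ r a c p q :=
  h.reverse.not_rel_left p q

theorem cases_of_rel (h : IsExtremal r a b c) {v x y : α} (h' : r v x v y) :
    v = a ∨ (v = c ∧ y = a) ∨ (x = c ∧ y = a) ∨ (v = b ∧ x = a) ∨ (x = a ∧ y = b) ∨
      (x ≠ a ∧ v = c ∧ y = b) ∨ (y ≠ a ∧ v = b ∧ x = c) ∨ (v ≠ a ∧ x = c ∧ y = b) := by
  have := h.ne
  have := h.cherry h'
  have := h.cherry (h.lowest _ _ _ _ h')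
  have := h.cherry (h.highest _ _ _ _ h')
  grind

variable [Fintype α]

open scoped Classical in
theorem cmpCount_le_sum (h : IsExtremal r a b c) : cmpCount r ≤
    #{p : α × α | r a p.1 a p.2} + #{p | r c p c a} + #{p | r p c p a} + #{p | r b a b p} +
      #{p | r p a p b} + #{p | p ≠ a ∧ r c p c b} + #{p | p ≠ a ∧ r b c b p} +
      #{p | p ≠ a ∧ r p c p b} := by
  have hsub : (univ.filter fun t : α × α × α => r t.1 t.2.1 t.1 t.2.2) ⊆
      ((((((({p : α × α | r a p.1 a p.2} : Finset _).image (fun p => (a, p.1, p.2)) ∪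
        ({p | r c p c a} : Finset α).image (fun p => (c, p, a))) ∪
        ({p | r p c p a} : Finset α).image (fun p => (p, c, a))) ∪
        ({p | r b a b p} : Finset α).image (fun p => (b, a, p))) ∪
        ({p | r p a p b} : Finset α).image (fun p => (p, a, b))) ∪
        ({p | p ≠ a ∧ r c p c b} : Finset α).image (fun p => (c, p, b))) ∪
        ({p | p ≠ a ∧ r b c b p} : Finset α).image (fun p => (b, c, p))) ∪
        ({p | p ≠ a ∧ r p c p b} : Finset α).image (fun p => (p, c, b)) := by
    rintro ⟨v, x, y⟩ ht
    have ht' : r v x v y := by simpa using ht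
    have := h.cases_of_rel ht'
    simp only [mem_union, mem_image, mem_filter, mem_univ, true_and, Prod.mk.injEq, Prod.exists]
    rcases this with rfl | ⟨rfl, rfl⟩ | ⟨rfl, rfl⟩ | ⟨rfl, rfl⟩ | ⟨rfl, rfl⟩ | ⟨hn, rfl, rfl⟩ |
      ⟨hn, rfl, rfl⟩ | ⟨hn, rfl, rfl⟩ <;> simp [*]
  refine (card_le_card hsub).trans ?_
  repeat' refine (card_union_le _ _).trans (add_le_add ?_ card_image_le)
  exact card_image_le

open scoped Classical in
theorem card_rel_add_two_le (h : IsExtremal r a b c) : #{p | r c p c a} + 2 ≤ Fintype.card α := by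
  rw [← card_pair h.ne.2.1]
  refine card_add_card_le_card_univ ?_
  simp only [disjoint_left, mem_filter, mem_univ, true_and, mem_insert, mem_singleton]
  intro p hp
  have := h.cherry hp
  grind

open scoped Classical in
theorem card_rel_add_two_le' (h : IsExtremal r a b c) : #{p | r b a b p} + 2 ≤ Fintype.card α :=
  h.reverse.card_rel_add_two_le

open scoped Classical in
theorem card_rel_le_one (h : IsExtremal r a b c) : #{p | r p c p a} ≤ 1 := by
  simp only [card_le_one, mem_filter, mem_univ, true_and]
  intro p hp q hq
  have := h.ne
  have := h.cherry hp
  have := h.cherry hq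
  rcases h.ferrers hp hq with h' | h' <;> have := h.cherry h' <;> grind

open scoped Classical in
theorem card_rel_le_one' (h : IsExtremal r a b c) : #{p | r p a p b} ≤ 1 :=
  h.reverse.card_rel_le_one

open scoped Classical in
theorem card_rel_ne_le_one (h : IsExtremal r a b c) : #{p | p ≠ a ∧ r p c p b} ≤ 1 := by
  simp only [card_le_one, mem_filter, mem_univ, true_and]
  rintro p ⟨-, hp⟩ q ⟨-, hq⟩
  have := h.ne
  have := h.cherry hp
  have := h.cherry hq
  rcases h.ferrers hp hq with h' | h' <;> have := h.cherry h' <;> grind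

open scoped Classical in
theorem two_mul_card_star_le (h : IsExtremal r a b c) :
    2 * #{p : α × α | r a p.1 a p.2} ≤ (Fintype.card α - 1) * (Fintype.card α - 2) := by
  have hsub : ({p : α × α | r a p.1 a p.2} : Finset _) ∪ ({p : α × α | r a p.2 a p.1} : Finset _) ⊆
      (univ.erase a).offDiag := by
    rintro ⟨x, y⟩ hxy
    simp only [mem_union, mem_filter, mem_univ, true_and] at hxy
    rcases hxy with h' | h' <;> have := h.cherry h' <;> simp [mem_offDiag] <;> grind
  have hdisj : Disjoint ({p : α × α | r a p.1 a p.2} : Finset _)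
      ({p : α × α | r a p.2 a p.1} : Finset _) := by
    simp only [disjoint_left, mem_filter, mem_univ, true_and]
    intro p hp hp'
    have := h.cherry (h.trans hp hp')
    grind
  have hcard : #{p : α × α | r a p.2 a p.1} = #{p : α × α | r a p.1 a p.2} :=
    card_bij (fun p _ => p.swap) (by simp) (fun p _ q _ => by simp)
      (fun p hp => ⟨p.swap, by simpa using hp, by simp⟩)
  have := card_le_card hsub
  rw [card_union_of_disjoint hdisj, hcard, offDiag_card, card_erase_of_mem (mem_univ _),
    card_univ] at this
  have e : Fintype.card α - 2 = Fintype.card α - 1 - 1 := rfl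
  rw [e, Nat.mul_sub_one, two_mul]
  exact this

open scoped Classical in
theorem card_star_add_five_le (h : IsExtremal r a b c) {q : α}
    (hq : ∀ x y, r a x a y → x = b ∨ y = c ∨ x = q ∨ y = q) :
    #{p : α × α | r a p.1 a p.2} + 5 ≤ 2 * Fintype.card α + #{y | y ≠ c ∧ r a q a y} +
      #{x | x ≠ b ∧ r a x a q} := by
  have hne := h.ne
  have hsub : ({p : α × α | r a p.1 a p.2} : Finset _) ⊆
      ((({y | r a b a y} : Finset α).image (fun y => (b, y)) ∪
        ({x | x ≠ b ∧ r a x a c} : Finset α).image (fun x => (x, c))) ∪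
        ({y | y ≠ c ∧ r a q a y} : Finset α).image (fun y => (q, y))) ∪
        ({x | x ≠ b ∧ r a x a q} : Finset α).image (fun x => (x, q)) := by
    rintro ⟨x, y⟩ hxy
    have hxy' : r a x a y := by simpa using hxy
    simp only [mem_union, mem_image, mem_filter, mem_univ, true_and, Prod.mk.injEq]
    have := hq x y hxy'
    grind
  have h₁ : #{y | r a b a y} + 2 ≤ Fintype.card α := by
    rw [← card_pair hne.1]
    refine card_add_card_le_card_univ ?_
    simp only [disjoint_left, mem_filter, mem_univ, true_and, mem_insert, mem_singleton]
    intro p hp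
    have := h.cherry hp
    grind
  have h₂ : #{x | x ≠ b ∧ r a x a c} + 3 ≤ Fintype.card α := by
    rw [← card_eq_three.2 ⟨a, b, c, hne.1, hne.2.1, hne.2.2, rfl⟩]
    refine card_add_card_le_card_univ ?_
    simp only [disjoint_left, mem_filter, mem_univ, true_and, mem_insert, mem_singleton]
    rintro p ⟨hb, hp⟩
    have := h.cherry hp
    grind
  have h₃ := card_le_card hsub
  have h₄ := (h₃.trans (card_union_le _ _)).trans
    (add_le_add ((card_union_le _ _).trans (add_le_add (card_union_le _ _) le_rfl)) le_rfl)
  have h₅ := h₄.trans (add_le_add (add_le_add (add_le_add card_image_le card_image_le)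
    card_image_le) card_image_le)
  omega

open scoped Classical in
theorem card_add_card_add_four_le (h : IsExtremal r a b c) {q : α} (ha : q ≠ a) (hb : q ≠ b)
    (hc : q ≠ c) :
    #{y | y ≠ c ∧ r a q a y} + #{x | x ≠ b ∧ r a x a q} + 4 ≤ Fintype.card α := by
  have hne := h.ne
  have hdisj : Disjoint ({y | y ≠ c ∧ r a q a y} : Finset α)
      ({x | x ≠ b ∧ r a x a q} : Finset α) := by
    simp only [disjoint_left, mem_filter, mem_univ, true_and]
    rintro p ⟨-, hp⟩ ⟨-, hp'⟩
    have := h.cherry (h.trans hp hp')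
    grind
  have hfour : #({a, b, c, q} : Finset α) = 4 := by
    rw [card_insert_of_notMem (by grind), card_insert_of_notMem (by grind), card_pair hc.symm]
  rw [← card_union_of_disjoint hdisj, ← hfour]
  refine card_add_card_le_card_univ ?_
  simp only [disjoint_left, mem_union, mem_filter, mem_univ, true_and, mem_insert, mem_singleton]
  rintro p (⟨hpc, hp⟩ | ⟨hpb, hp⟩) hmem
  · have := h.cherry hp
    have := h.not_rel_left a q
    grind
  · have := h.cherry hp
    have := h.not_rel_right a q
    grind

/-- There is a pair `bc, bq` of comparable edges avoiding `a`. -/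
theorem cmpCount_add_ten_le_of_rel (h : IsExtremal r a b c) (hcard : 6 ≤ Fintype.card α) {q : α}
    (hqa : q ≠ a) (hq : r b c b q) : cmpCount r + 10 ≤ 5 * Fintype.card α := by
  classical
  have hne := h.ne
  have hq' := h.cherry hq
  have hsum := h.cmpCount_le_sum
  have hA₂ := h.card_rel_add_two_le
  have hB₂ := h.card_rel_le_one
  have hA₃ := h.card_rel_add_two_le'
  have hB₃ := h.card_rel_le_one'
  have hR := h.card_rel_ne_le_one
  have hstar : ∀ x y, r a x a y → x = b ∨ y = c ∨ x = q ∨ y = q := by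
    intro x y hxy
    have := h.not_rel_left a x
    have := h.cherry hxy
    rcases h.ferrers hxy hq with h' | h' <;> have := h.cherry h' <;> grind
  have hS := h.card_star_add_five_le hstar
  have hX : #{x | x ≠ b ∧ r a x a q} = 0 := by
    simp only [card_eq_zero, filter_eq_empty_iff, mem_univ, true_implies]
    rintro x ⟨hxb, hx⟩
    have := h.cherry hx
    rcases h.ferrers hx hq with h' | h' <;> have := h.cherry h' <;> grind
  have hY := h.card_add_card_add_four_le hqa (by grind) (by grind)
  have hB : ∀ p, r p c p a → ∀ q, q ≠ a → r b c b q → p = q := by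
    intro p hp q hqa hq
    have := h.cherry hp
    have := h.cherry hq
    have hba : ¬ r b c b a := fun h' => h.not_rel_left b c (h.swap_right h')
    rcases h.ferrers hp hq with h' | h' <;> have := h.cherry h' <;> grind
  have hP : ∀ p, r c p c b → ∀ q, q ≠ a → r b c b q → p = q := by
    intro p hp q hqa hq
    have := h.cherry hp
    have := h.cherry hq
    rcases h.ferrers hp hq with h' | h' <;> have := h.cherry h' <;> grind
  have hP₁ : #{p | p ≠ a ∧ r c p c b} ≤ 1 := by
    simp only [card_le_one, mem_filter, mem_univ, true_and]
    rintro p ⟨-, hp⟩ p' ⟨-, hp'⟩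
    rw [hP p hp q hqa hq, hP p' hp' q hqa hq]
  have hQ₃ : #{p | p ≠ a ∧ r b c b p} + 3 ≤ Fintype.card α := by
    rw [← card_eq_three.2 ⟨a, b, c, hne.1, hne.2.1, hne.2.2, rfl⟩]
    refine card_add_card_le_card_univ ?_
    simp only [disjoint_left, mem_filter, mem_univ, true_and, mem_insert, mem_singleton]
    rintro p ⟨hb, hp⟩
    have := h.cherry hp
    grind
  rcases Finset.eq_empty_or_nonempty ({y | y ≠ c ∧ r a q a y} : Finset α) with hY₀ | ⟨y, hy⟩
  · rw [hY₀, card_empty] at hS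
    by_cases hQ : #{p | p ≠ a ∧ r b c b p} ≤ 1
    · omega
    · obtain ⟨q', hq'mem, hqq⟩ := exists_mem_ne (not_le.1 hQ) q
      simp only [mem_filter, mem_univ, true_and] at hq'mem
      have hB₀ : #{p | r p c p a} = 0 := by
        simp only [card_eq_zero, filter_eq_empty_iff, mem_univ, true_implies]
        intro p hp
        exact hqq ((hB p hp q' hq'mem.1 hq'mem.2).symm.trans (hB p hp q hqa hq))
      have hP₀ : #{p | p ≠ a ∧ r c p c b} = 0 := by
        simp only [card_eq_zero, filter_eq_empty_iff, mem_univ, true_implies]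
        rintro p ⟨-, hp⟩
        exact hqq ((hP p hp q' hq'mem.1 hq'mem.2).symm.trans (hP p hp q hqa hq))
      omega
  · simp only [mem_filter, mem_univ, true_and] at hy
    obtain ⟨hyc, hy⟩ := hy
    have hy' := h.cherry hy
    have hyb : y ≠ b := by rintro rfl; exact h.not_rel_left _ _ hy
    have hB₀ : #{p | r p c p a} = 0 := by
      simp only [card_eq_zero, filter_eq_empty_iff, mem_univ, true_implies]
      intro p hp
      obtain rfl := hB p hp q hqa hq
      have := h.cherry (h.trans (h.swap_left hp) (h.swap_left hy))
      have := h.cherry (h.trans hp (h.swap_left hy))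
      grind
    have hP₀ : #{p | p ≠ a ∧ r c p c b} = 0 := by
      simp only [card_eq_zero, filter_eq_empty_iff, mem_univ, true_implies]
      rintro p ⟨-, hp⟩
      obtain rfl := hP p hp q hqa hq
      rcases h.ferrers hp hy with h' | h' <;> have := h.cherry h' <;> grind
    have hQ₁ : #{p | p ≠ a ∧ r b c b p} ≤ 1 := by
      simp only [card_le_one, mem_filter, mem_univ, true_and]
      have key : ∀ p, p ≠ a → r b c b p → p = q := by
        intro p hpa hp
        have := h.cherry hp
        rcases h.ferrers hp hy with h' | h' <;> have := h.cherry h' <;> grind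
      rintro p ⟨hpa, hp⟩ p' ⟨hpa', hp'⟩
      rw [key p hpa hp, key p' hpa' hp']
    omega

theorem cmpCount_le (h : IsExtremal r a b c) (hcard : 6 ≤ Fintype.card α) :
    cmpCount r + 10 ≤ 5 * Fintype.card α ∨ (∀ v x y, r v x v y → v = a ∨ x = a ∨ y = a) ∧
      2 * cmpCount r ≤ (Fintype.card α - 1) * (Fintype.card α + 2) := by
  classical
  by_cases hQ : ∃ q, q ≠ a ∧ r b c b q
  · obtain ⟨q, hqa, hq⟩ := hQ
    exact .inl (h.cmpCount_add_ten_le_of_rel hcard hqa hq)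
  by_cases hP : ∃ p, p ≠ a ∧ r c p c b
  · obtain ⟨p, hpa, hp⟩ := hP
    rw [← cmpCount_reverse]
    exact .inl (h.reverse.cmpCount_add_ten_le_of_rel hcard hpa hp)
  have hsum := h.cmpCount_le_sum
  have hA₂ := h.card_rel_add_two_le
  have hB₂ := h.card_rel_le_one
  have hA₃ := h.card_rel_add_two_le'
  have hB₃ := h.card_rel_le_one'
  have hR := h.card_rel_ne_le_one
  have hQ₀ : #{p | p ≠ a ∧ r b c b p} = 0 := by
    simpa [filter_eq_empty_iff] using hQ
  have hP₀ : #{p | p ≠ a ∧ r c p c b} = 0 := by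
    simpa [filter_eq_empty_iff] using hP
  by_cases hR' : ∃ p, p ≠ a ∧ r p c p b
  · obtain ⟨p, hpa, hp⟩ := hR'
    left
    have hp' := h.cherry hp
    have hstar : ∀ x y, r a x a y → x = b ∨ y = c ∨ x = p ∨ y = p := by
      intro x y hxy
      have := h.ne
      have := h.cherry hxy
      rcases h.ferrers hxy hp with h' | h' <;> have := h.cherry h' <;> grind
    have hS := h.card_star_add_five_le hstar
    have hY := h.card_add_card_add_four_le hpa (by grind) (by grind)
    omega
  · right
    push Not at hQ hP hR'
    constructor
    · intro v x y hvxy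
      have := h.cases_of_rel hvxy
      grind
    · have hR₀ : #{p | p ≠ a ∧ r p c p b} = 0 := by
        simpa [filter_eq_empty_iff] using hR'
      have hS := h.two_mul_card_star_le
      obtain ⟨m, hm⟩ : ∃ m, Fintype.card α = m + 2 := ⟨_, (Nat.sub_add_cancel (by omega)).symm⟩
      rw [hm] at hS hA₂ hA₃ ⊢
      simp only [Nat.add_sub_cancel, show m + 2 - 1 = m + 1 by omega] at hS ⊢
      nlinarith

end IsExtremal

theorem IsLineIntervalOrder.cmpCount_le {α : Type*} [Fintype α] {r : α → α → α → α → Prop}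
    (hr : IsLineIntervalOrder r) (hcard : 6 ≤ Fintype.card α) :
    cmpCount r + 10 ≤ 5 * Fintype.card α ∨ ∃ a, (∀ v x y, r v x v y → v = a ∨ x = a ∨ y = a) ∧
      2 * cmpCount r ≤ (Fintype.card α - 1) * (Fintype.card α + 2) := by
  by_cases h : ∃ p q s t, r p q s t
  · obtain ⟨p, q, s, t, h⟩ := h
    obtain ⟨a, b, c, habc, hlow, hhigh⟩ := hr.exists_extremal h
    exact (IsExtremal.cmpCount_le ⟨hr, habc, hlow, hhigh⟩ hcard).imp_right fun h => ⟨a, h⟩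
  · push Not at h
    left
    have : cmpCount r = 0 := by simp [cmpCount, h]
    omega


open Finset in
theorem card_mul_le_sum_cmpCount {α ι : Type*} [Fintype α] [Fintype ι]
    {r : ι → α → α → α → α → Prop}
    (hcov : ∀ v x y, v ≠ x → v ≠ y → x ≠ y → ∃ i, Cmp (r i) v x y) :
    Fintype.card α * ((Fintype.card α - 1) * (Fintype.card α - 2)) ≤
      2 * ∑ i, cmpCount (r i) := by
  classical
  let T : Finset (Σ _ : α, α × α) := univ.sigma fun v => (univ.erase v).offDiag
  have hT : #T = Fintype.card α * ((Fintype.card α - 1) * (Fintype.card α - 2)) := by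
    have e : Fintype.card α - 2 = Fintype.card α - 1 - 1 := rfl
    simp only [T, card_sigma, offDiag_card, card_erase_of_mem (mem_univ _), card_univ, sum_const,
      smul_eq_mul, e, Nat.mul_sub_one]
  let A : ι → Finset (α × α × α) := fun i => univ.filter fun t => r i t.1 t.2.1 t.1 t.2.2
  have hsub : T ⊆ univ.biUnion fun i => (A i).image (fun t => ⟨t.1, t.2.1, t.2.2⟩) ∪
      (A i).image (fun t => ⟨t.1, t.2.2, t.2.1⟩) := by
    rintro ⟨v, x, y⟩ h
    simp only [T, mem_sigma, mem_offDiag, mem_erase, mem_univ, and_true, true_and] at h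
    obtain ⟨i, hi | hi⟩ := hcov v x y (Ne.symm h.1) (Ne.symm h.2.1) h.2.2
    · exact mem_biUnion.2 ⟨i, mem_univ _, mem_union_left _
        (mem_image.2 ⟨(v, x, y), by simpa [A] using hi, rfl⟩)⟩
    · exact mem_biUnion.2 ⟨i, mem_univ _, mem_union_right _
        (mem_image.2 ⟨(v, y, x), by simpa [A] using hi, rfl⟩)⟩
  rw [← hT, mul_sum]
  refine (card_le_card hsub).trans (card_biUnion_le.trans (sum_le_sum fun i _ => ?_))
  rw [two_mul]
  exact (card_union_le _ _).trans (add_le_add card_image_le card_image_le)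

/-- On seven vertices, no three of four covering interval orders are centred. -/
theorem false_of_three_centred {α ι : Type*} [Fintype α] [Fintype ι]
    {r : ι → α → α → α → α → Prop} (hα : Fintype.card α = 7) (hι : Fintype.card ι ≤ 4)
    (hr : ∀ i, IsLineIntervalOrder (r i))
    (hcov : ∀ v x y, v ≠ x → v ≠ y → x ≠ y → ∃ i, Cmp (r i) v x y)
    {i₁ i₂ i₃ : ι} (h₁₂ : i₁ ≠ i₂) (h₁₃ : i₁ ≠ i₃) (h₂₃ : i₂ ≠ i₃) {u₁ u₂ u₃ : α}
    (hu₁ : ∀ v x y, r i₁ v x v y → v = u₁ ∨ x = u₁ ∨ y = u₁)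
    (hu₂ : ∀ v x y, r i₂ v x v y → v = u₂ ∨ x = u₂ ∨ y = u₂)
    (hu₃ : ∀ v x y, r i₃ v x v y → v = u₃ ∨ x = u₃ ∨ y = u₃) : False := by
  classical
  have hthree : ({u₁, u₂, u₃} : Finset α).card ≤ 3 := Finset.card_le_three
  obtain ⟨W, hW, hW4⟩ := Finset.exists_subset_card_eq
    (s := ({u₁, u₂, u₃} : Finset α)ᶜ) (n := 4) (by rw [Finset.card_compl]; omega)
  obtain ⟨u, hu⟩ : (W ∪ {u₂, u₃})ᶜ.Nonempty := by
    rw [← Finset.card_pos, Finset.card_compl]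
    have := Finset.card_union_le W {u₂, u₃}
    have := Finset.card_le_two (a := u₂) (b := u₃)
    omega
  have hWu : ∀ v ∈ W, v ≠ u₁ ∧ v ≠ u₂ ∧ v ≠ u₃ := fun v hv => by simpa using hW hv
  simp only [Finset.mem_compl, Finset.mem_union, Finset.mem_insert, Finset.mem_singleton,
    not_or] at hu
  obtain ⟨huW, hu2, hu3⟩ := hu
  have hc2 : ∀ v ∈ W, ∀ x ∈ W, ∀ y, y = u ∨ y ∈ W → ¬ Cmp (r i₂) v x y := by
    intro v hv x hx y hy
    have := hWu v hv
    have := hWu x hx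
    rintro (h | h) <;> have := hu₂ _ _ _ h <;> grind
  have hc3 : ∀ v ∈ W, ∀ x ∈ W, ∀ y, y = u ∨ y ∈ W → ¬ Cmp (r i₃) v x y := by
    intro v hv x hx y hy
    have := hWu v hv
    have := hWu x hx
    rintro (h | h) <;> have := hu₃ _ _ _ h <;> grind
  have hc1 : ∀ v ∈ W, ∀ x ∈ W, ∀ y ∈ W, ¬ r i₁ v x v y := by
    intro v hv x hx y hy h
    have := hu₁ _ _ _ h
    grind
  obtain ⟨a, b, c, d, hab, hac, had, hbc, hbd, hcd, rfl⟩ := Finset.card_eq_four.1 hW4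
  obtain ⟨j, hj⟩ := hcov a b c hab hac hbc
  have hj1 : j ≠ i₁ := by
    rintro rfl
    rcases hj with h | h <;> exact hc1 _ (by simp) _ (by simp) _ (by simp) h
  have hj2 : j ≠ i₂ := by
    rintro rfl
    exact hc2 _ (by simp) _ (by simp) _ (by simp) hj
  have hj3 : j ≠ i₃ := by
    rintro rfl
    exact hc3 _ (by simp) _ (by simp) _ (by simp) hj
  have hall : ∀ i, i = j ∨ i = i₁ ∨ i = i₂ ∨ i = i₃ := by
    intro i
    by_contra! hne
    have h3 : ({i₁, i₂, i₃} : Finset ι).card = 3 :=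
      Finset.card_eq_three.2 ⟨_, _, _, h₁₂, h₁₃, h₂₃, rfl⟩
    have h5 : ({i, j, i₁, i₂, i₃} : Finset ι).card = 5 := by
      rw [Finset.card_insert_of_notMem (by simp; grind),
        Finset.card_insert_of_notMem (by simp; grind), h3]
    have := Finset.card_le_univ ({i, j, i₁, i₂, i₃} : Finset ι)
    omega
  refine (hr j).false_of_four (hr i₁) (W := (({a, b, c, d} : Finset α) : Set α)) (u := u)
    (by simpa using huW) (a := a) (b := b) (c := c) (d := d) (by simp) (by simp) (by simp)
    (by simp) hab hac had hbc hbd hcd ?_ hc1 ?_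
  · intro v hv x hx y hy hvx hvy hxy
    obtain ⟨i, hi⟩ := hcov v x y hvx hvy hxy
    rcases hall i with rfl | rfl | rfl | rfl
    · exact hi
    · rcases hi with h | h
      · exact (hc1 v hv x hx y hy h).elim
      · exact (hc1 v hv y hy x hx h).elim
    · exact (hc2 v hv x hx y (.inr hy) hi).elim
    · exact (hc3 v hv x hx y (.inr hy) hi).elim
  · intro v hv x hx hvx
    obtain ⟨i, hi⟩ := hcov v x u hvx (fun h => huW (h ▸ hv)) (fun h => huW (h ▸ hx))
    rcases hall i with rfl | rfl | rfl | rfl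
    · exact .inl hi
    · exact .inr hi
    · exact (hc2 v hv x hx u (.inl rfl) hi).elim
    · exact (hc3 v hv x hx u (.inl rfl) hi).elim

theorem false_of_card_eq_seven {α ι : Type*} [Fintype α] [Fintype ι]
    {r : ι → α → α → α → α → Prop} (hα : Fintype.card α = 7) (hι : Fintype.card ι ≤ 4)
    (hr : ∀ i, IsLineIntervalOrder (r i))
    (hcov : ∀ v x y, v ≠ x → v ≠ y → x ≠ y → ∃ i, Cmp (r i) v x y) : False := by
  classical
  have hcount := card_mul_le_sum_cmpCount hcov
  rw [hα] at hcount
  have hle : ∀ i, cmpCount (r i) ≤ 25 ∨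
      ∃ u, (∀ v x y, r i v x v y → v = u ∨ x = u ∨ y = u) ∧ cmpCount (r i) ≤ 27 := by
    intro i
    rcases (hr i).cmpCount_le (by omega) with h | ⟨u, hu, h⟩ <;> rw [hα] at h
    · exact .inl (by omega)
    · exact .inr ⟨u, hu, by omega⟩
  let C : Finset ι := {i | 25 < cmpCount (r i)}
  have hC : ∀ i ∈ C, ∃ u, ∀ v x y, r i v x v y → v = u ∨ x = u ∨ y = u := by
    intro i hi
    have hi' : 25 < cmpCount (r i) := by simpa [C] using hi
    rcases hle i with h | ⟨u, hu, -⟩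
    · omega
    · exact ⟨u, hu⟩
  by_cases hC2 : C.card ≤ 2
  · have hsum : ∑ i, cmpCount (r i) ≤ ∑ i, (25 + if i ∈ C then 2 else 0) := by
      refine Finset.sum_le_sum fun i _ => ?_
      have := hle i
      split_ifs with hi
      · rcases this with h | ⟨_, -, h⟩ <;> omega
      · have : ¬ 25 < cmpCount (r i) := by simpa [C] using hi
        omega
    rw [Finset.sum_add_distrib, Finset.sum_ite_mem, Finset.univ_inter, Finset.sum_const,
      Finset.sum_const, Finset.card_univ, smul_eq_mul, smul_eq_mul] at hsum
    omega
  · obtain ⟨i₁, i₂, i₃, h₁, h₂, h₃, h₁₂, h₁₃, h₂₃⟩ := Finset.two_lt_card_iff.1 (not_le.1 hC2)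
    obtain ⟨u₁, hu₁⟩ := hC _ h₁
    obtain ⟨u₂, hu₂⟩ := hC _ h₂
    obtain ⟨u₃, hu₃⟩ := hC _ h₃
    exact false_of_three_centred hα hι hr hcov h₁₂ h₁₃ h₂₃ hu₁ hu₂ hu₃

/-- The pairs of adjacent edges of a complete graph on `n ≥ 7` vertices are not covered by `n - 3`
interval orders all of whose comparable edges are adjacent. -/
theorem card_lt_card_add_three_of_cover {α ι : Type*} [Fintype α] [Fintype ι]
    {r : ι → α → α → α → α → Prop} (hα : 7 ≤ Fintype.card α)
    (hr : ∀ i, IsLineIntervalOrder (r i))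
    (hcov : ∀ v x y, v ≠ x → v ≠ y → x ≠ y → ∃ i, Cmp (r i) v x y) :
    Fintype.card α < Fintype.card ι + 3 := by
  classical
  induction hn : Fintype.card α using Nat.strong_induction_on generalizing α ι with
  | _ n ih =>
  by_contra! hι
  rcases (hn ▸ hα : 7 ≤ n).eq_or_lt with h7 | h8
  · exact false_of_card_eq_seven (by omega) (by omega) hr hcov
  by_cases hcen : ∃ i u, ∀ v x y, r i v x v y → v = u ∨ x = u ∨ y = u
  · obtain ⟨i, u, hu⟩ := hcen
    have hcα : Fintype.card {x // x ≠ u} = n - 1 := by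
      rw [Fintype.card_subtype_compl, Fintype.card_subtype_eq, hn]
    have hcι : Fintype.card {j // j ≠ i} = Fintype.card ι - 1 := by
      rw [Fintype.card_subtype_compl, Fintype.card_subtype_eq]
    have : 0 < Fintype.card ι := Fintype.card_pos_iff.2 ⟨i⟩
    have := ih (n - 1) (by omega) (α := {x // x ≠ u}) (ι := {j // j ≠ i})
      (r := fun j a b c d => r j a b c d) (by omega)
      (fun j => (hr j).comap (Function.Embedding.subtype _)) ?_ hcα
    · omega
    · rintro ⟨v, hv⟩ ⟨x, hx⟩ ⟨y, hy⟩ hvx hvy hxy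
      obtain ⟨j, hj⟩ := hcov v x y (by simpa using hvx) (by simpa using hvy) (by simpa using hxy)
      refine ⟨⟨j, ?_⟩, hj⟩
      rintro rfl
      rcases hj with h | h <;> have := hu _ _ _ h <;> grind
  · have hle : ∀ i, cmpCount (r i) ≤ 5 * n - 10 := by
      intro i
      rcases (hr i).cmpCount_le (by omega) with h | ⟨u, hu, -⟩
      · omega
      · exact (hcen ⟨i, u, hu⟩).elim
    have hcount := card_mul_le_sum_cmpCount hcov
    have hsum := Finset.sum_le_card_nsmul Finset.univ _ _ fun i _ => hle i
    rw [Finset.card_univ, smul_eq_mul] at hsum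
    obtain ⟨m, rfl⟩ : ∃ m, n = m + 8 := ⟨n - 8, by omega⟩
    have h₁ := Nat.mul_le_mul_right (5 * (m + 8) - 10) (show Fintype.card ι ≤ m + 5 by omega)
    rw [hn, show m + 8 - 1 = m + 7 by omega, show m + 8 - 2 = m + 6 by omega] at hcount
    rw [show 5 * (m + 8) - 10 = 5 * m + 30 by omega] at hsum h₁
    nlinarith [Nat.zero_le (m ^ 3), Nat.zero_le (m ^ 2)]

namespace SimpleGraph

theorem exists_isBoxRep {V : Type*} [Finite V] (G : SimpleGraph V) : ∃ d I, G.IsBoxRep d I := by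
  classical
  obtain ⟨d, ⟨e⟩⟩ := Finite.exists_equiv_fin (V × V)
  refine ⟨d, fun v i => Set.Icc
    (if v = (e.symm i).2 ∧ (e.symm i).1 ≠ (e.symm i).2 ∧ ¬ G.Adj (e.symm i).1 (e.symm i).2
      then 1 else 0)
    (if v = (e.symm i).1 ∧ (e.symm i).1 ≠ (e.symm i).2 ∧ ¬ G.Adj (e.symm i).1 (e.symm i).2
      then 0 else 1), fun v i => ⟨_, _, ?_, rfl⟩, fun u v huv => ⟨fun h i => ?_, fun h => ?_⟩⟩
  · split_ifs <;> grind
  · rw [Set.Icc_inter_Icc, Set.nonempty_Icc, sup_le_iff, le_inf_iff, le_inf_iff]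
    have := h.symm
    refine ⟨⟨?_, ?_⟩, ?_, ?_⟩ <;> split_ifs <;> grind
  · by_contra hadj
    have := h (e (u, v))
    simp [huv, huv.symm, hadj] at this

theorem isLineIntervalOrder_of_isBoxRep {V : Type*} {d : ℕ}
    {lo hi : (⊤ : SimpleGraph V).edgeSet → Fin d → ℝ} (hlo : ∀ e i, lo e i ≤ hi e i)
    (h : ((⊤ : SimpleGraph V).lineGraph)ᶜ.IsBoxRep d fun e i => Set.Icc (lo e i) (hi e i))
    (i : Fin d) : IsLineIntervalOrder fun a b c d => ∃ (he : s(a, b) ∈ (⊤ : SimpleGraph V).edgeSet)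
      (hf : s(c, d) ∈ (⊤ : SimpleGraph V).edgeSet), hi ⟨s(a, b), he⟩ i < lo ⟨s(c, d), hf⟩ i where
  swap_left := by
    intro a b c d ⟨he, hf, hlt⟩
    simp only [Sym2.eq_swap (a := b) (b := a)]
    exact ⟨he, hf, hlt⟩
  swap_right := by
    intro a b c d ⟨he, hf, hlt⟩
    simp only [Sym2.eq_swap (a := d) (b := c)]
    exact ⟨he, hf, hlt⟩
  ferrers := by
    rintro a b c d a' b' c' d' ⟨he, hf, hlt⟩ ⟨he', hf', hlt'⟩
    rcases le_or_gt (lo ⟨s(c, d), hf⟩ i) (lo ⟨s(c', d'), hf'⟩ i) with hle | hgt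
    · exact .inl ⟨he, hf', hlt.trans_le hle⟩
    · exact .inr ⟨he', hf, hlt'.trans hgt⟩
  cherry := by
    rintro a b c d ⟨he, hf, hlt⟩
    have hne : (⟨s(a, b), he⟩ : (⊤ : SimpleGraph V).edgeSet) ≠ ⟨s(c, d), hf⟩ := by
      intro heq
      rw [heq] at hlt
      exact (hlo _ i).not_gt hlt
    have hadj : (⊤ : SimpleGraph V).lineGraph.Adj ⟨s(a, b), he⟩ ⟨s(c, d), hf⟩ := by
      by_contra hnot
      have hmeet := ((h.2 _ _ hne).1 (by rw [compl_adj]; exact ⟨hne, hnot⟩)) i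
      obtain ⟨t, ht, ht'⟩ := hmeet
      exact (ht.2.trans_lt hlt).not_ge ht'.1
    obtain ⟨-, w, hw, hw'⟩ := hadj
    simp only [SetLike.mem_coe, Sym2.mem_iff] at hw hw'
    simp only [ne_eq, Subtype.mk.injEq, Sym2.eq_iff, not_or, not_and] at hne
    have hab : a ≠ b := by simpa using he
    have hcd : c ≠ d := by simpa using hf
    clear he hf hlt
    refine ⟨hab, hcd, ?_⟩
    rcases hw with rfl | rfl <;> rcases hw' with rfl | rfl <;> tauto

theorem exists_cmp_of_isBoxRep {V : Type*} {d : ℕ}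
    {lo hi : (⊤ : SimpleGraph V).edgeSet → Fin d → ℝ} (hlo : ∀ e i, lo e i ≤ hi e i)
    (h : ((⊤ : SimpleGraph V).lineGraph)ᶜ.IsBoxRep d fun e i => Set.Icc (lo e i) (hi e i))
    {v x y : V} (hvx : v ≠ x) (hvy : v ≠ y) (hxy : x ≠ y) :
    ∃ i, Cmp (fun a b c d => ∃ (he : s(a, b) ∈ (⊤ : SimpleGraph V).edgeSet)
      (hf : s(c, d) ∈ (⊤ : SimpleGraph V).edgeSet), hi ⟨s(a, b), he⟩ i < lo ⟨s(c, d), hf⟩ i)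
      v x y := by
  have he : s(v, x) ∈ (⊤ : SimpleGraph V).edgeSet := by simpa using hvx
  have hf : s(v, y) ∈ (⊤ : SimpleGraph V).edgeSet := by simpa using hvy
  have hne : (⟨s(v, x), he⟩ : (⊤ : SimpleGraph V).edgeSet) ≠ ⟨s(v, y), hf⟩ := by
    simpa [Sym2.eq_iff, hvy] using fun h => (hxy h).elim
  have hadj : (⊤ : SimpleGraph V).lineGraph.Adj ⟨s(v, x), he⟩ ⟨s(v, y), hf⟩ :=
    ⟨hne, v, by simp, by simp⟩
  by_contra! hnot
  refine absurd ((h.2 _ _ hne).2 fun i => ?_) fun hc => ((compl_adj _ _ _).1 hc).2 hadj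
  have hi' := hnot i
  simp only [Cmp, not_or, not_exists, not_lt] at hi'
  rw [Set.Icc_inter_Icc, Set.nonempty_Icc, sup_le_iff, le_inf_iff, le_inf_iff]
  exact ⟨⟨hlo _ i, hi'.2 hf he⟩, hi'.1 he hf, hlo _ i⟩

end SimpleGraph

/-- For every `n ≥ 7`, the boxicity of the complement of `L(K_n)` is at least `n - 2`. -/
theorem boxicity_compl_lineGraph_complete_ge (n : ℕ) (hn : 7 ≤ n) :
    n - 2 ≤ ((⊤ : SimpleGraph (Fin n)).lineGraph)ᶜ.boxicity := by
  refine le_csInf (SimpleGraph.exists_isBoxRep _) ?_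
  rintro d ⟨I, hI⟩
  choose lo hi hlo hIcc using hI.1
  obtain rfl : I = fun e i => Set.Icc (lo e i) (hi e i) := funext₂ hIcc
  have := card_lt_card_add_three_of_cover (α := Fin n) (ι := Fin d) (by simpa using hn)
    (SimpleGraph.isLineIntervalOrder_of_isBoxRep hlo hI)
    fun v x y => SimpleGraph.exists_cmp_of_isBoxRep hlo hI
  simp only [Fintype.card_fin] at this
  omega
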